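/- Let A be a C*-algebra, let z ∈ A be positive with ‖z‖ = 1, and let 0 < δ₀ < 1 and 0 < δ < 1 satisfy ((δ/(2−δ))·(1 − δ₀/2))² > 1 − δ₀. Let d ∈ A be positive with ‖d‖ = 1 lying in the hereditary C*-subalgebra generated by (z^{1/2} − δ)₊, i.e., d ∈ closure((z^{1/2} − δ)₊ A (z^{1/2} − δ)₊), and let e ∈ A be a projection with ‖e d e‖ > 1 − δ₀/2. Then ‖e z e‖ > 1 − δ₀. -/

import Mathlib

/-- A projection in a C*-algebra: a self-adjoint idempotent. -/
def IsProjection {A : Type*} [NonUnitalCStarAlgebra A] (p : A) : Prop :=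
  IsSelfAdjoint p ∧ p * p = p

/-- `(c - t)₊`, via the (non-unital) continuous functional calculus. -/
noncomputable def cutPos {A : Type*} [NonUnitalCStarAlgebra A] (c : A) (t : ℝ) : A :=
  cfcₙ (fun s : ℝ => max (s - t) 0) c

/-- Truncating `y` at `t ≥ 0` acts as multiplication by `t` on `(y - t)₊`. -/
lemma cfcₙ_min_mul_cutPos {A : Type*} [NonUnitalCStarAlgebra A] (y : A) {t : ℝ} (ht : 0 ≤ t) :
    cfcₙ (fun s : ℝ => min s t) y * cutPos y t = t • cutPos y t := by
  unfold cutPos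
  rw [← cfcₙ_mul _ _ y (by fun_prop) (by simp [ht]) (by fun_prop) (by simp [ht]),
    ← cfcₙ_smul t _ y (by fun_prop) (by simp [ht])]
  refine cfcₙ_congr fun s _ => ?_
  rcases le_total s t with h | h
  · simp [h]
  · simp [h]

lemma cutPos_mul_cfcₙ_min {A : Type*} [NonUnitalCStarAlgebra A] (y : A) {t : ℝ} (ht : 0 ≤ t) :
    cutPos y t * cfcₙ (fun s : ℝ => min s t) y = t • cutPos y t := by
  rw [← cfcₙ_min_mul_cutPos y ht]
  exact cfcₙ_commute_cfcₙ _ _ y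

/-- A positive element of the hereditary subalgebra generated by `(z^{1/2} - t)₊` is, after
scaling by `t ^ 2`, bounded by a multiple of `z`. -/
lemma sq_smul_le_of_mem_closure_cutPos {A : Type*} [NonUnitalCStarAlgebra A] [PartialOrder A]
    [StarOrderedRing A] {z d : A} (hz : 0 ≤ z) {t : ℝ} (ht : 0 ≤ t) (hd : 0 ≤ d)
    (hdmem : d ∈ closure
      {w : A | ∃ a : A, w = cutPos (CFC.sqrt z) t * a * cutPos (CFC.sqrt z) t}) :
    t ^ 2 • d ≤ ‖d‖ • z := by
  have hy : 0 ≤ CFC.sqrt z := CFC.sqrt_nonneg z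
  set y := CFC.sqrt z with hy_def
  set h := cfcₙ (fun s : ℝ => min s t) y with h_def
  have hh : IsSelfAdjoint h := cfcₙ_predicate _ y
  have hdh : h * d * h = t ^ 2 • d := by
    have hclosed : IsClosed {w : A | h * w * h = t ^ 2 • w} :=
      isClosed_eq (by fun_prop) (by fun_prop)
    refine closure_minimal ?_ hclosed hdmem
    rintro _ ⟨a, rfl⟩
    calc h * (cutPos y t * a * cutPos y t) * h
        = (h * cutPos y t) * a * (cutPos y t * h) := by simp only [mul_assoc]
      _ = t ^ 2 • (cutPos y t * a * cutPos y t) := by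
        rw [cfcₙ_min_mul_cutPos y ht, cutPos_mul_cfcₙ_min y ht]
        simp only [smul_mul_assoc, mul_smul_comm, smul_smul, sq]
  have hhz : h * h ≤ z := by
    have hzy : z = cfcₙ (fun s : ℝ => s * s) y := by
      rw [cfcₙ_mul (fun s : ℝ => s) (fun s : ℝ => s) y, cfcₙ_id' ℝ y,
        CFC.sqrt_mul_sqrt_self z hz]
    rw [hzy, h_def, ← cfcₙ_mul _ _ y (by fun_prop) (by simp [ht]) (by fun_prop) (by simp [ht])]
    refine cfcₙ_mono (fun s hs => ?_) (by fun_prop) (by fun_prop) (by simp [ht]) (by simp)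
    have hs0 : 0 ≤ s := quasispectrum_nonneg_of_nonneg y hy s hs
    exact mul_self_le_mul_self (le_min hs0 ht) (min_le_left s t)
  calc t ^ 2 • d = star h * d * h := by rw [hh.star_eq, hdh]
    _ ≤ ‖d‖ • (star h * h) := CStarAlgebra.star_left_conjugate_le_norm_smul
    _ ≤ ‖d‖ • z := by
      rw [hh.star_eq]
      exact smul_le_smul_of_nonneg_left hhz (norm_nonneg d)

/-- The claim (9) in the proof of Lemma 2.4: if `z` is positive of norm one,
`0 < δ₀ < 1` and `0 < δ < 1` satisfy `((δ/(2−δ))(1−δ₀/2))² > 1−δ₀`, `d` is a positive norm-one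
element of the hereditary C*-subalgebra generated by `(z^{1/2} − δ)₊`, and `e` is a projection
with `‖ede‖ > 1 − δ₀/2`, then `‖eze‖ > 1 − δ₀`. -/
theorem norm_eze_gt
    {A : Type*} [NonUnitalCStarAlgebra A] [PartialOrder A] [StarOrderedRing A]
    (z : A) (hz : 0 ≤ z) (hz1 : ‖z‖ = 1)
    (δ₀ δ : ℝ) (hδ₀ : 0 < δ₀) (hδ₀1 : δ₀ < 1) (hδ : 0 < δ) (hδ1 : δ < 1)
    (hineq : ((δ / (2 - δ)) * (1 - δ₀ / 2)) ^ 2 > 1 - δ₀)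
    (d : A) (hd : 0 ≤ d) (hd1 : ‖d‖ = 1)
    (hdmem : d ∈ closure
      {w : A | ∃ a : A, w = cutPos (CFC.sqrt z) δ * a * cutPos (CFC.sqrt z) δ})
    (e : A) (he : IsProjection e)
    (hede : ‖e * d * e‖ > 1 - δ₀ / 2) :
    ‖e * z * e‖ > 1 - δ₀ := by
  have hle := sq_smul_le_of_mem_closure_cutPos hz hδ.le hd hdmem
  rw [hd1, one_smul] at hle
  have hconj : δ ^ 2 • (e * d * e) ≤ e * z * e := by
    have := star_left_conjugate_le_conjugate hle e
    rwa [he.1.star_eq, mul_smul_comm, smul_mul_assoc] at this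
  have hnonneg : 0 ≤ δ ^ 2 • (e * d * e) := by
    have := star_left_conjugate_nonneg hd e
    rw [he.1.star_eq] at this
    exact smul_nonneg (sq_nonneg δ) this
  have hnorm : δ ^ 2 * ‖e * d * e‖ ≤ ‖e * z * e‖ := by
    have := CStarAlgebra.norm_le_norm_of_nonneg_of_le hnonneg hconj
    rwa [norm_smul, Real.norm_of_nonneg (sq_nonneg δ)] at this
  have hfrac : δ / (2 - δ) ≤ δ := div_le_self hδ.le (by linarith)
  have hfrac0 : 0 ≤ δ / (2 - δ) := div_nonneg hδ.le (by linarith)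
  calc 1 - δ₀ < (δ / (2 - δ) * (1 - δ₀ / 2)) ^ 2 := hineq
    _ = (δ / (2 - δ)) ^ 2 * (1 - δ₀ / 2) ^ 2 := mul_pow _ _ _
    _ ≤ δ ^ 2 * (1 - δ₀ / 2) := by
      refine mul_le_mul (pow_le_pow_left₀ hfrac0 hfrac 2) ?_ (sq_nonneg _) (sq_nonneg _)
      exact pow_le_of_le_one (by linarith) (by linarith) two_ne_zero
    _ ≤ δ ^ 2 * ‖e * d * e‖ := mul_le_mul_of_nonneg_left hede.le (sq_nonneg δ)
    _ ≤ ‖e * z * e‖ := hnorm
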